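/- arXiv:1912.00629 — 6 statements merged into one kernel-verified Lean document; each statement's English description precedes it below -/
import Mathlib

section
/- For every pair (θ, c) ∈ Θ and every natural number x, the inequality 2·θ(x) ≤ θ(2·c + 2·x) holds. -/
/-- The inductively defined class Θ of pairs (θ, c): `(id, 0) ∈ Θ`;
if `(θ, c) ∈ Θ` then `(x ↦ 2·θ x, c) ∈ Θ`; and if `(θ, c) ∈ Θ` and `b ≥ 1`
then `(x ↦ b + θ x, c + b) ∈ Θ`. -/
inductive Theta : (ℕ → ℕ) → ℕ → Prop
  | id : Theta (fun x => x) 0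
  | double {θ : ℕ → ℕ} {c : ℕ} : Theta θ c → Theta (fun x => 2 * θ x) c
  | add {θ : ℕ → ℕ} {c : ℕ} (b : ℕ) : Theta θ c → 1 ≤ b →
      Theta (fun x => b + θ x) (c + b)

theorem Theta.add_le_apply_add {θ : ℕ → ℕ} {c : ℕ} (h : Theta θ c) (x d : ℕ) :
    θ x + d ≤ θ (x + d) := by
  induction h with
  | id => exact le_rfl
  | double _ ih => lia
  | add b _ _ ih => lia

theorem theta_two_mul (θ : ℕ → ℕ) (c : ℕ) (h : Theta θ c) (x : ℕ) :
    2 * θ x ≤ θ (2 * c + 2 * x) := by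
  induction h with
  | id => lia
  | double _ ih => lia
  | @add θ c b h _ ih =>
    have key := h.add_le_apply_add (2 * c + 2 * x) (2 * b)
    rw [show 2 * c + 2 * x + 2 * b = 2 * (c + b) + 2 * x by ring] at key
    lia
end

section
/- Every pair (θ, c) ∈ Θ admits a normal form: there exist a natural number q, natural numbers k_0, k_1, …, k_q with k_i ≥ 1 for every i with 1 ≤ i ≤ q−1 (k_0 and k_q may be 0), and natural numbers b_0, …, b_{q−1} with each b_i ≥ 1, such that c = b_0 + b_1 + ⋯ + b_{q−1} and, for every natural number x, θ(x) = 2^{k_0}·b_0 + 2^{k_0+k_1}·b_1 + ⋯ + 2^{k_0+k_1+⋯+k_{q−1}}·b_{q−1} + 2^{k_0+k_1+⋯+k_q}·x. -/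
theorem theta_normal_form (θ : ℕ → ℕ) (c : ℕ) (h : Theta θ c) :
    ∃ (q : ℕ) (k : ℕ → ℕ) (b : ℕ → ℕ),
      (∀ i : ℕ, 1 ≤ i → i ≤ q - 1 → 1 ≤ k i) ∧
      (∀ i : ℕ, i < q → 1 ≤ b i) ∧
      c = ∑ i ∈ Finset.range q, b i ∧
      ∀ x : ℕ,
        θ x = (∑ i ∈ Finset.range q,
                 2 ^ (∑ j ∈ Finset.range (i + 1), k j) * b i)
              + 2 ^ (∑ j ∈ Finset.range (q + 1), k j) * x := by
  induction h with
  | id => exact ⟨0, fun _ => 0, fun _ => 0, by omega, by omega, by simp, by simp⟩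
  | @double θ c _ ih =>
    obtain ⟨q, k, b, hk, hb, hc, hθ⟩ := ih
    refine ⟨q, fun i => if i = 0 then k 0 + 1 else k i, b, fun i hi hiq => ?_, hb, hc,
      fun x => ?_⟩
    · have := hk i hi hiq
      simpa [Nat.one_le_iff_ne_zero.mp hi] using this
    · have hsum (n : ℕ) : ∑ j ∈ Finset.range (n + 1), (if j = 0 then k 0 + 1 else k j) =
          (∑ j ∈ Finset.range (n + 1), k j) + 1 := by
        simp [Finset.sum_range_succ', add_assoc]
      simp only [hsum, hθ, mul_add, Finset.mul_sum, pow_succ]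
      congr 1
      · exact Finset.sum_congr rfl fun i _ => by ring
      · ring
  | @add θ c a _ ha ih =>
    obtain ⟨q, k, b, hk, hb, hc, hθ⟩ := ih
    by_cases hq : 1 ≤ q ∧ k 0 = 0
    · obtain ⟨hq, hk0⟩ := hq
      obtain ⟨p, rfl⟩ := Nat.exists_eq_add_of_le' hq
      refine ⟨p + 1, k, fun i => if i = 0 then a + b 0 else b i, hk, fun i hi => ?_, ?_,
        fun x => ?_⟩
      · have := hb i hi
        dsimp only
        split_ifs <;> omega
      · rw [hc]
        simp only [Finset.sum_range_succ' _ p]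
        simp
        ring
      · dsimp only
        rw [hθ, Finset.sum_range_succ' _ p, Finset.sum_range_succ' (n := p)]
        simp [hk0]
        ring
    · refine ⟨q + 1, fun i => if i = 0 then 0 else k (i - 1),
        fun i => if i = 0 then a else b (i - 1), fun i hi hiq => ?_, fun i hi => ?_, ?_,
        fun x => ?_⟩
      · have hi0 : i ≠ 0 := by omega
        simp only [hi0, if_false]
        rcases eq_or_ne i 1 with rfl | hi1
        · rw [Nat.sub_self]
          omega
        · exact hk (i - 1) (by omega) (by omega)
      · dsimp only
        split_ifs
        · exact ha
        · exact hb (i - 1) (by omega)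
      · simp [Finset.sum_range_succ' _ q, hc]
      · have hsum (n : ℕ) :
            ∑ j ∈ Finset.range (n + 1), (if j = 0 then 0 else k (j - 1)) =
              ∑ j ∈ Finset.range n, k j := by
          simp [Finset.sum_range_succ']
        simp only [hsum, hθ]
        rw [Finset.sum_range_succ' (fun i => _ * ite (i = 0) _ _) q]
        simp
        ring
end

section
/- For every pair (θ, c) ∈ Θ and all natural numbers u, v with u ≥ 2 and v ≥ 2, the strict inequality θ(2^u) + θ(2^v) < 2^{θ(u+v)} holds. -/
theorem Theta.le_apply {θ : ℕ → ℕ} {c : ℕ} (h : Theta θ c) (x : ℕ) : x ≤ θ x := by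
  induction h <;> lia

theorem theta_pow_add_pow_lt (θ : ℕ → ℕ) (c : ℕ) (h : Theta θ c)
    (u v : ℕ) (hu : 2 ≤ u) (hv : 2 ≤ v) :
    θ (2 ^ u) + θ (2 ^ v) < 2 ^ θ (u + v) := by
  have two_le {θ : ℕ → ℕ} {c : ℕ} (h : Theta θ c) : 2 ≤ 2 ^ θ (u + v) :=
    Nat.le_self_pow (by have := h.le_apply (u + v); lia) 2
  induction h with
  | id =>
    have hu' : 2 ^ 2 ≤ 2 ^ u := Nat.pow_le_pow_right two_pos hu
    have hv' : 2 ^ 2 ≤ 2 ^ v := Nat.pow_le_pow_right two_pos hv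
    rw [pow_add]
    nlinarith
  | double h ih =>
    have := two_le h
    simp only [two_mul, pow_add]
    nlinarith
  | @add θ _ b h hb ih =>
    have := two_le h
    have hb' : b + 1 ≤ 2 ^ b := b.lt_two_pow_self
    have := Nat.mul_le_mul_right (2 ^ θ (u + v)) hb'
    rw [pow_add]
    nlinarith
end

section
/- For every pair (θ, c) ∈ Θ and every natural number u with u ≥ 2 and c < u, the strict inequality 2·θ(2^u) < 2^{θ(4·u)} holds. -/
theorem theta_rule19_base (θ : ℕ → ℕ) (c : ℕ) (h : Theta θ c)
    (u : ℕ) (hu : 2 ≤ u) (hcu : c < u) :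
    2 * θ (2 ^ u) < 2 ^ θ (4 * u) := by
  clear hcu
  induction h with
  | id =>
    calc 2 * 2 ^ u = 2 ^ (u + 1) := by ring
      _ < 2 ^ (4 * u) := Nat.pow_lt_pow_right (by norm_num) (by omega)
  | @double θ c h ih =>
    have hm : 4 * u ≤ θ (4 * u) := h.le_apply _
    calc 2 * (2 * θ (2 ^ u)) < 2 * 2 ^ θ (4 * u) := by omega
      _ = 2 ^ (θ (4 * u) + 1) := by ring
      _ ≤ 2 ^ (2 * θ (4 * u)) := Nat.pow_le_pow_right (by norm_num) (by omega)
  | @add θ c b h _ ih =>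
    have hm : 4 * u ≤ θ (4 * u) := h.le_apply _
    have h2 : 2 ^ 1 ≤ 2 ^ θ (4 * u) := Nat.pow_le_pow_right (by norm_num) (by omega)
    have hb2 : b + 1 ≤ 2 ^ b := Nat.lt_two_pow_self
    calc 2 * (b + θ (2 ^ u)) < b * 2 + 2 ^ θ (4 * u) := by omega
      _ ≤ b * 2 ^ θ (4 * u) + 2 ^ θ (4 * u) := by gcongr; exact h2
      _ = (b + 1) * 2 ^ θ (4 * u) := by ring
      _ ≤ 2 ^ b * 2 ^ θ (4 * u) := by gcongr
      _ = 2 ^ (b + θ (4 * u)) := by rw [pow_add]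
end

section
/- Let (θ_A, c) ∈ Θ, let (θ_F, c') ∈ Θ, and let u be a natural number with u ≥ 2 and c < u. Then the strict inequality θ_F(2·θ_A(2^u)) < θ_A(2^{θ_F(4·u)}) holds. -/
/-- Every function in `Θ` is affine, with positive slope `p` and intercept at most `p * c`. -/
theorem Theta.exists_affine {θ : ℕ → ℕ} {c : ℕ} (h : Theta θ c) :
    ∃ p q : ℕ, 1 ≤ p ∧ q ≤ p * c ∧ ∀ x, θ x = p * x + q := by
  induction h with
  | id => exact ⟨1, 0, le_rfl, Nat.zero_le _, fun x => by simp⟩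
  | double _ ih =>
    obtain ⟨p, q, hp, hq, h⟩ := ih
    exact ⟨2 * p, 2 * q, by omega, by nlinarith, fun x => by simp only [h]; ring⟩
  | add b _ _ ih =>
    obtain ⟨p, q, hp, hq, h⟩ := ih
    exact ⟨p, q + b, hp, by nlinarith [Nat.mul_le_mul_right b hp], fun x => by simp only [h]; ring⟩

theorem four_mul_mul_two_pow_add_le {r u : ℕ} (s : ℕ) (hr : 1 ≤ r) (hu : 2 ≤ u) :
    4 * r * 2 ^ u + s ≤ 2 ^ (r * (4 * u) + s) := by
  have hexp : 4 * r + u ≤ r * (4 * u) := by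
    obtain ⟨v, rfl⟩ := Nat.exists_eq_add_of_le hu
    nlinarith [Nat.mul_le_mul_right v hr]
  have hbase : 4 * r * 2 ^ u ≤ 2 ^ (r * (4 * u)) :=
    calc 4 * r * 2 ^ u ≤ 2 ^ (4 * r) * 2 ^ u :=
          Nat.mul_le_mul_right _ Nat.lt_two_pow_self.le
      _ = 2 ^ (4 * r + u) := (pow_add _ _ _).symm
      _ ≤ 2 ^ (r * (4 * u)) := Nat.pow_le_pow_right two_pos hexp
  have hs : s + 1 ≤ 2 ^ s := Nat.lt_two_pow_self
  have hone : 1 ≤ 2 ^ (r * (4 * u)) := Nat.one_le_two_pow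
  rw [pow_add]
  generalize 2 ^ (r * (4 * u)) = a at *
  nlinarith [Nat.mul_le_mul_left a hs, Nat.mul_le_mul_right s hone]

theorem theta_rule18 (θA : ℕ → ℕ) (c : ℕ) (hA : Theta θA c)
    (θF : ℕ → ℕ) (c' : ℕ) (hF : Theta θF c')
    (u : ℕ) (hu : 2 ≤ u) (hcu : c < u) :
    θF (2 * θA (2 ^ u)) < θA (2 ^ θF (4 * u)) := by
  obtain ⟨p, q, hp, hq, hθA⟩ := hA.exists_affine
  obtain ⟨r, s, hr, -, hθF⟩ := hF.exists_affine
  simp only [hθA, hθF]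
  have hc : c < 2 ^ u := hcu.trans Nat.lt_two_pow_self
  have hq' : q < p * 2 ^ u := hq.trans_lt (Nat.mul_lt_mul_of_pos_left hc hp)
  calc r * (2 * (p * 2 ^ u + q)) + s
      < r * (2 * (p * 2 ^ u + p * 2 ^ u)) + s := by gcongr
    _ ≤ p * (4 * r * 2 ^ u + s) := by nlinarith [Nat.mul_le_mul_right s hp]
    _ ≤ p * 2 ^ (r * (4 * u) + s) :=
        Nat.mul_le_mul_left p (four_mul_mul_two_pow_add_le s hr hu)
    _ ≤ p * 2 ^ (r * (4 * u) + s) + q := Nat.le_add_right _ _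
end

section
/- Let (θ_A, c) ∈ Θ, let (θ_F, c') ∈ Θ, and let u be a natural number with u ≥ 2 and c < u. Then the strict inequality θ_F(2·θ_A(2^u)) < 2^{θ_A(θ_F(4·u))} holds. -/
theorem Theta.add_le {θ : ℕ → ℕ} {c : ℕ} (h : Theta θ c) (x n : ℕ) :
    θ x + n ≤ θ (x + n) := by
  induction h with
  | id => exact le_rfl
  | double _ ih => dsimp only; omega
  | add b _ _ ih => dsimp only; omega

theorem add_two_mul_lt_two_pow {x e : ℕ} (b : ℕ) (he : 1 ≤ e) (h : x < 2 ^ e) :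
    2 * b + x < 2 ^ (b + e) := by
  have hb : b + 1 ≤ 2 ^ b := Nat.lt_two_pow_self
  have h2 : 2 ≤ 2 ^ e := Nat.le_self_pow (by omega) 2
  rw [pow_add]
  nlinarith [Nat.mul_le_mul_right (2 ^ e) hb, Nat.mul_le_mul_left b h2]

theorem two_mul_lt_two_pow {x e f : ℕ} (hef : e < f) (h : x < 2 ^ e) :
    2 * x < 2 ^ f := by
  calc 2 * x < 2 ^ (e + 1) := by rw [pow_succ]; omega
    _ ≤ 2 ^ f := Nat.pow_le_pow_right (by norm_num) hef

theorem Theta.two_mul_apply_two_pow_lt {θ : ℕ → ℕ} {c : ℕ} (h : Theta θ c) {u : ℕ}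
    (hu : 1 ≤ u) : 2 * θ (2 ^ u) < 2 ^ θ (4 * u) := by
  induction h with
  | id =>
    dsimp only
    exact two_mul_lt_two_pow (e := u + 1) (by omega)
      (Nat.pow_lt_pow_right (by norm_num) u.lt_succ_self)
  | double h ih =>
    have := h.le_apply (4 * u)
    dsimp only
    exact two_mul_lt_two_pow (by omega) ih
  | add b h _ ih =>
    have := h.le_apply (4 * u)
    dsimp only
    rw [Nat.mul_add]
    exact add_two_mul_lt_two_pow b (by omega) ih

theorem theta_rule19 (θA : ℕ → ℕ) (c : ℕ) (hA : Theta θA c)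
    (θF : ℕ → ℕ) (c' : ℕ) (hF : Theta θF c')
    (u : ℕ) (hu : 2 ≤ u) (hcu : c < u) :
    θF (2 * θA (2 ^ u)) < 2 ^ θA (θF (4 * u)) := by
  induction hF with
  | id => exact hA.two_mul_apply_two_pow_lt (by omega)
  | @double θ _ h ih =>
    have hpos := h.le_apply (4 * u)
    have hstep := hA.add_le (θ (4 * u)) (θ (4 * u))
    rw [← Nat.two_mul] at hstep
    dsimp only
    exact two_mul_lt_two_pow (by omega) ih
  | @add θ _ b h _ ih =>
    have hpos := (h.le_apply (4 * u)).trans (hA.le_apply _)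
    have hstep := hA.add_le (θ (4 * u)) b
    have hlt := add_two_mul_lt_two_pow b (by omega) ih
    rw [Nat.add_comm b] at hlt
    calc b + θ (2 * θA (2 ^ u)) < 2 ^ (θA (θ (4 * u)) + b) := by omega
      _ ≤ 2 ^ θA (b + θ (4 * u)) :=
        Nat.pow_le_pow_right (by norm_num) (by rwa [Nat.add_comm b])
end
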